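/- For any P ∈ 𝔓̄_+ \ {0} and c ∈ ℭ_+, the sublevel sets J_P^{−1}((−∞, r]) ⊆ 𝔓̄_+ \ {0} are compact for all r ∈ ℝ. -/

import Mathlib

open MeasureTheory Complex Set

noncomputable section

namespace RCE

/-- The scalar product (k,θ) = Σⱼ kⱼ θⱼ. -/
def dotP (d : ℕ) (k : Fin d → ℤ) (θ : Fin d → ℝ) : ℝ := ∑ j, (k j : ℝ) * θ j

/-- The d-dimensional torus 𝕋^d = (−π,π]^d. -/
def Td (d : ℕ) : Set (Fin d → ℝ) := Set.univ.pi fun _ => Set.Ioc (-Real.pi) Real.pi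

/-- Normalized Lebesgue measure dm = (2π)^{-d} dθ on 𝕋^d. -/
def dm (d : ℕ) : Measure (Fin d → ℝ) :=
  (ENNReal.ofReal ((2 * Real.pi) ^ d))⁻¹ • (volume.restrict (Td d))

/-- Conjugate-symmetric coefficient sequences supported on Λ. -/
def IsCoeff (d : ℕ) (Λ : Finset (Fin d → ℤ)) (p : (Fin d → ℤ) → ℂ) : Prop :=
  (∀ k, k ∉ Λ → p k = 0) ∧ ∀ k, p (-k) = starRingEnd ℂ (p k)

/-- Evaluation of the (real-valued) trigonometric polynomial
`P(e^{iθ}) = Σ_{k∈Λ} p_k e^{-i(k,θ)}`. -/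
def eval (d : ℕ) (Λ : Finset (Fin d → ℤ)) (p : (Fin d → ℤ) → ℂ) (θ : Fin d → ℝ) : ℝ :=
  (∑ k ∈ Λ, p k * Complex.exp (-(dotP d k θ : ℂ) * Complex.I)).re

/-- `𝔓̄₊` : the closed cone of nonnegative trigonometric polynomials. -/
def Pbar (d : ℕ) (Λ : Finset (Fin d → ℤ)) : Set ((Fin d → ℤ) → ℂ) :=
  {p | IsCoeff d Λ p ∧ ∀ θ ∈ Td d, 0 ≤ eval d Λ p θ}

/-- `𝔓₊` : the open cone of positive trigonometric polynomials. -/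
def Pplus (d : ℕ) (Λ : Finset (Fin d → ℤ)) : Set ((Fin d → ℤ) → ℂ) :=
  {p | IsCoeff d Λ p ∧ ∀ θ ∈ Td d, 0 < eval d Λ p θ}

/-- The pairing ⟨c,p⟩ = Σ_{k∈Λ} c_k conj(p_k) (real-valued by conjugate symmetry). -/
def pair (d : ℕ) (Λ : Finset (Fin d → ℤ)) (c p : (Fin d → ℤ) → ℂ) : ℝ :=
  (∑ k ∈ Λ, c k * starRingEnd ℂ (p k)).re

/-- `ℭ₊` : the interior of the dual cone. -/
def Cplus (d : ℕ) (Λ : Finset (Fin d → ℤ)) : Set ((Fin d → ℤ) → ℂ) :=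
  {c | IsCoeff d Λ c ∧ ∀ p ∈ Pbar d Λ, p ≠ 0 → 0 < pair d Λ c p}

/-- `ℭ̄₊` : the closed dual cone. -/
def Cbar (d : ℕ) (Λ : Finset (Fin d → ℤ)) : Set ((Fin d → ℤ) → ℂ) :=
  {c | IsCoeff d Λ c ∧ ∀ p ∈ Pbar d Λ, 0 ≤ pair d Λ c p}

/-- The dual functional J_P(Q) = ⟨c,q⟩ − ∫ P log Q dm. -/
def J (d : ℕ) (Λ : Finset (Fin d → ℤ)) (c P Q : (Fin d → ℤ) → ℂ) : ℝ :=
  pair d Λ c Q - ∫ θ, eval d Λ P θ * Real.log (eval d Λ Q θ) ∂(dm d)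

/-- Covariance matching for an absolutely continuous measure Φ dm:
`c_k = ∫ e^{i(k,θ)} Φ(θ) dm(θ)` for all k ∈ Λ. -/
def Matches (d : ℕ) (Λ : Finset (Fin d → ℤ)) (c : (Fin d → ℤ) → ℂ)
    (Φ : (Fin d → ℝ) → ℝ) : Prop :=
  ∀ k ∈ Λ, c k = ∫ θ, Complex.exp ((dotP d k θ : ℂ) * Complex.I) * (Φ θ : ℂ) ∂(dm d)

theorem measurePreserving_toIocMod_add (v : ℝ) :
    MeasurePreserving (fun x => toIocMod Real.two_pi_pos (-Real.pi) (x + v))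
      (volume.restrict (Ioc (-Real.pi) Real.pi)) (volume.restrict (Ioc (-Real.pi) Real.pi)) := by
  have : Fact (0 < 2 * Real.pi) := ⟨Real.two_pi_pos⟩
  have e : -Real.pi + 2 * Real.pi = Real.pi := by ring
  have h1 := AddCircle.measurePreserving_mk (2 * Real.pi) (-Real.pi)
  have h2 := measurePreserving_add_right (volume : Measure (AddCircle (2 * Real.pi)))
    (v : AddCircle (2 * Real.pi))
  have h3 := AddCircle.measurePreserving_equivIoc (2 * Real.pi) (a := -Real.pi)
  have h4 := measurePreserving_subtype_coe (μa := (volume : Measure ℝ))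
    (measurableSet_Ioc (a := -Real.pi) (b := -Real.pi + 2 * Real.pi))
  have := h4.comp (h3.comp (h2.comp h1))
  exact (congrArg (fun b => MeasurePreserving
    (fun x => toIocMod Real.two_pi_pos (-Real.pi) (x + v)) (volume.restrict (Ioc (-Real.pi) b))
      (volume.restrict (Ioc (-Real.pi) b))) e).mp this

theorem measurePreserving_pi_toIocMod_add {ι : Type*} [Fintype ι] (v : ι → ℝ) :
    MeasurePreserving (fun (θ : ι → ℝ) j => toIocMod Real.two_pi_pos (-Real.pi) (θ j + v j))
      (volume.restrict (univ.pi fun _ => Ioc (-Real.pi) Real.pi))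
      (volume.restrict (univ.pi fun _ => Ioc (-Real.pi) Real.pi)) := by
  rw [volume_pi, Measure.restrict_pi_pi]
  exact measurePreserving_pi _ _ fun j => measurePreserving_toIocMod_add (v j)

theorem lintegral_pi_Ioc_add_eq {ι : Type*} [Fintype ι] {h : (ι → ℝ) → ENNReal} (hm : Measurable h)
    (hper : ∀ θ (n : ι → ℤ), h (fun j => θ j + n j * (2 * Real.pi)) = h θ) (v : ι → ℝ) :
    ∫⁻ θ in univ.pi fun _ => Ioc (-Real.pi) Real.pi, h (θ + v) =
      ∫⁻ θ in univ.pi fun _ => Ioc (-Real.pi) Real.pi, h θ := by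
  rw [← (measurePreserving_pi_toIocMod_add v).lintegral_comp hm]
  refine lintegral_congr fun θ => ?_
  rw [← hper (fun j => toIocMod Real.two_pi_pos (-Real.pi) (θ j + v j))
    fun j => toIocDiv Real.two_pi_pos (-Real.pi) (θ j + v j)]
  congr 1
  ext j
  simpa only [zsmul_eq_mul, Pi.add_apply] using
    (toIocMod_add_toIocDiv_zsmul Real.two_pi_pos (-Real.pi) (θ j + v j)).symm

/-- If the integrals of a `2π`-periodic function along parallel segments are uniformly
bounded, then its integral over the torus is finite. -/
theorem lintegral_pi_Ioc_lt_top {ι : Type*} [Fintype ι] {h : (ι → ℝ) → ENNReal} (hm : Measurable h)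
    (hper : ∀ θ (n : ι → ℤ), h (fun j => θ j + n j * (2 * Real.pi)) = h θ) (u : ι → ℝ)
    {C : ENNReal} (hC : C ≠ ⊤)
    (hb : ∀ θ, ∫⁻ t in Ioc 0 (2 * Real.pi), h (θ + t • u) ≤ C) :
    ∫⁻ θ in univ.pi fun _ => Ioc (-Real.pi) Real.pi, h θ < ⊤ := by
  have hvol : volume (univ.pi fun _ : ι => Ioc (-Real.pi) Real.pi) ≠ ⊤ := by
    simp [volume_pi, Measure.pi_pi]
  have h1 : ∫⁻ t in Ioc 0 (2 * Real.pi), ∫⁻ θ in univ.pi fun _ => Ioc (-Real.pi) Real.pi,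
      h (θ + t • u) < ⊤ := by
    rw [lintegral_lintegral_swap (by fun_prop)]
    calc _ ≤ ∫⁻ θ in univ.pi fun _ : ι => Ioc (-Real.pi) Real.pi, C := lintegral_mono hb
      _ < ⊤ := by
        rw [setLIntegral_const]
        exact ENNReal.mul_lt_top hC.lt_top hvol.lt_top
  simp_rw [lintegral_pi_Ioc_add_eq hm hper] at h1
  rw [setLIntegral_const] at h1
  refine ENNReal.lt_top_of_mul_ne_top_left h1.ne ?_
  simp [Real.pi_pos]

/-- The nonnegative loss `log M - log x`, with value `⊤` at `x = 0`. -/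
def logLoss (M x : ℝ) : ENNReal :=
  if x = 0 then ⊤ else ENNReal.ofReal (Real.log M - Real.log x)

theorem measurable_logLoss (M : ℝ) : Measurable (logLoss M) :=
  Measurable.ite (measurableSet_singleton 0) measurable_const (by fun_prop)

open Polynomial in
theorem lintegral_logLoss_polynomial_le {p : ℂ[X]} {M a : ℝ} (ha : 0 < a)
    (hap : a ≤ p.mahlerMeasure) (hM : ∀ t, ‖p.eval (circleMap 0 1 t)‖ ≤ M) :
    ∫⁻ t in Ioc 0 (2 * Real.pi), logLoss M ‖p.eval (circleMap 0 1 t)‖ ≤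
      ENNReal.ofReal (2 * Real.pi * (Real.log M - Real.log a)) := by
  have hp : p ≠ 0 := by
    rintro rfl
    simp at hap
    linarith
  have h0 : ∀ᵐ t ∂(volume.restrict (Ioc 0 (2 * Real.pi))), ‖p.eval (circleMap 0 1 t)‖ ≠ 0 := by
    have hfin : {z | p.eval z = 0}.Finite := by
      simpa [IsRoot] using p.finite_setOfPred_isRoot hp
    have hc : (circleMap 0 1 ⁻¹' {z | p.eval z = 0}).Countable :=
      hfin.countable.preimage_circleMap 0 one_ne_zero
    have := ae_restrict_of_ae (s := Ioc 0 (2 * Real.pi)) (hc.ae_notMem (volume : Measure ℝ))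
    filter_upwards [this] with t ht
    simpa using ht
  have hint := p.intervalIntegrable_mahlerMeasure.1
  calc _ = ∫⁻ t in Ioc 0 (2 * Real.pi),
        ENNReal.ofReal (Real.log M - Real.log ‖p.eval (circleMap 0 1 t)‖) := by
        refine lintegral_congr_ae ?_
        filter_upwards [h0] with t ht
        rw [logLoss, if_neg ht]
    _ = ENNReal.ofReal (∫ t in Ioc 0 (2 * Real.pi),
        (Real.log M - Real.log ‖p.eval (circleMap 0 1 t)‖)) := by
        refine (ofReal_integral_eq_lintegral_ofReal ((integrable_const _).sub hint) ?_).symm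
        filter_upwards [h0] with t ht
        simpa using Real.log_le_log (lt_of_le_of_ne (norm_nonneg _) ht.symm) (hM t)
    _ ≤ _ := by
        refine ENNReal.ofReal_le_ofReal ?_
        rw [integral_sub (integrable_const _) hint]
        have hl := Real.log_le_log ha hap
        rw [← logMahlerMeasure_eq_log_MahlerMeasure, logMahlerMeasure_def,
          Real.circleAverage_def, smul_eq_mul,
          intervalIntegral.integral_of_le Real.two_pi_pos.le] at hl
        have h2 := Real.two_pi_pos
        rw [inv_mul_eq_div, le_div_iff₀ h2] at hl
        simp [max_eq_left h2.le]
        linarith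

/-- Finitely many distinct integer vectors are separated by an integer linear form. -/
theorem exists_injOn_sum_mul (d : ℕ) (Λ : Finset (Fin d → ℤ)) :
    ∃ u : Fin d → ℤ, Set.InjOn (fun k : Fin d → ℤ => ∑ j, k j * u j) Λ := by
  classical
  let f : (Fin d → ℤ) → Polynomial ℤ := fun k => ∑ j : Fin d, Polynomial.monomial (j : ℕ) (k j)
  have hf : ∀ k, k ≠ 0 → f k ≠ 0 := by
    intro k hk h
    apply hk
    ext j
    have := congrArg (fun q => q.coeff (j : ℕ)) h
    simpa [f, Polynomial.finsetSum_coeff, Polynomial.coeff_monomial, Fin.val_inj] using this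
  let F : Polynomial ℤ := ∏ x ∈ Λ.offDiag, f (x.1 - x.2)
  have hF : F ≠ 0 := Finset.prod_ne_zero_iff.2 fun x hx =>
    hf _ (sub_ne_zero.2 (Finset.mem_offDiag.1 hx).2.2)
  obtain ⟨N, hN⟩ : ∃ N, F.eval N ≠ 0 := by
    by_contra! h
    exact hF (Polynomial.funext fun N => by simpa using h N)
  refine ⟨fun j => N ^ (j : ℕ), fun k hk l hl hkl => ?_⟩
  by_contra hne
  rw [Polynomial.eval_prod, Finset.prod_ne_zero_iff] at hN
  refine hN (k, l) (Finset.mem_offDiag.2 ⟨hk, hl, hne⟩) ?_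
  simp only at hkl
  simp [f, Polynomial.eval_finsetSum, hkl]

variable {d : ℕ} {Λ : Finset (Fin d → ℤ)}

/-- The complex-valued trigonometric sum whose real part is `eval`. -/
def trigSum (d : ℕ) (Λ : Finset (Fin d → ℤ)) (p : (Fin d → ℤ) → ℂ) (θ : Fin d → ℝ) : ℂ :=
  ∑ k ∈ Λ, p k * Complex.exp (-(dotP d k θ : ℂ) * Complex.I)

/-- The `ℓ¹` norm of the coefficients in `Λ`. -/
def coeffNorm (Λ : Finset (Fin d → ℤ)) (p : (Fin d → ℤ) → ℂ) : ℝ := ∑ k ∈ Λ, ‖p k‖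

theorem norm_exp_dotP (k : Fin d → ℤ) (θ : Fin d → ℝ) :
    ‖Complex.exp (-(dotP d k θ : ℂ) * Complex.I)‖ = 1 := by
  rw [← Complex.ofReal_neg, Complex.norm_exp_ofReal_mul_I]

theorem norm_trigSum_le (p : (Fin d → ℤ) → ℂ) (θ : Fin d → ℝ) :
    ‖trigSum d Λ p θ‖ ≤ coeffNorm Λ p := by
  refine (norm_sum_le _ _).trans (Finset.sum_le_sum fun k _ => ?_)
  rw [norm_mul, norm_exp_dotP, mul_one]

theorem continuous_trigSum (p : (Fin d → ℤ) → ℂ) : Continuous (trigSum d Λ p) := by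
  unfold trigSum dotP
  fun_prop

theorem trigSum_add_two_pi (p : (Fin d → ℤ) → ℂ) (θ : Fin d → ℝ) (n : Fin d → ℤ) :
    trigSum d Λ p (fun j => θ j + n j * (2 * Real.pi)) = trigSum d Λ p θ := by
  refine Finset.sum_congr rfl fun k _ => ?_
  congr 1
  refine Complex.exp_eq_exp_iff_exists_int.2 ⟨-∑ j, k j * n j, ?_⟩
  have : dotP d k (fun j => θ j + n j * (2 * Real.pi)) =
      dotP d k θ + (∑ j, k j * n j : ℤ) * (2 * Real.pi) := by
    simp only [dotP, mul_add, Finset.sum_add_distrib, Int.cast_sum, Finset.sum_mul, Int.cast_mul,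
      mul_assoc]
  rw [this]
  push_cast
  ring

theorem ofReal_eval_eq_trigSum (hΛ : ∀ k ∈ Λ, -k ∈ Λ) {p : (Fin d → ℤ) → ℂ} (hp : IsCoeff d Λ p)
    (θ : Fin d → ℝ) : (eval d Λ p θ : ℂ) = trigSum d Λ p θ := by
  refine Complex.conj_eq_iff_re.1 ?_
  rw [map_sum]
  refine Finset.sum_nbij' (fun k => -k) (fun k => -k) hΛ hΛ (fun _ _ => neg_neg _)
    (fun _ _ => neg_neg _) fun k _ => ?_
  rw [map_mul, hp.2, ← Complex.exp_conj]
  congr 2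
  simp [dotP]

/-- Along a suitable integer direction a trigonometric sum is, up to a unimodular factor, an
algebraic polynomial on the unit circle. -/
theorem exists_polynomial_norm_trigSum_eq (Λ : Finset (Fin d → ℤ)) :
    ∃ (u : Fin d → ℝ) (e : (Fin d → ℤ) → ℕ), InjOn e Λ ∧
      ∀ p θ t, ‖trigSum d Λ p (θ + t • u)‖ = ‖Polynomial.eval (circleMap 0 1 t)
        (∑ k ∈ Λ, Polynomial.monomial (e k)
          (p k * Complex.exp (-(dotP d k θ : ℂ) * Complex.I)))‖ := by
  obtain ⟨u, hu⟩ := exists_injOn_sum_mul d Λ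
  let φ : (Fin d → ℤ) → ℤ := fun k => ∑ j, k j * u j
  let m : ℕ := ∑ k ∈ Λ, (φ k).natAbs
  have hm : ∀ k ∈ Λ, 0 ≤ φ k + m := fun k hk => by
    have : (φ k).natAbs ≤ m :=
      Finset.single_le_sum (f := fun k => (φ k).natAbs) (fun _ _ => Nat.zero_le _) hk
    omega
  refine ⟨fun j => -(u j : ℝ), fun k => (φ k + m).toNat, fun k hk l hl hkl => hu hk hl ?_, ?_⟩
  · have h1 := hm k hk
    have h2 := hm l hl
    change φ k = φ l
    simp only at hkl
    omega
  · intro p θ t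
    have hz : ∀ w : ℂ, ‖w‖ = ‖circleMap 0 1 t ^ m * w‖ := by simp
    rw [hz, trigSum, Finset.mul_sum, Polynomial.eval_finsetSum]
    congr 1
    refine Finset.sum_congr rfl fun k hk => ?_
    have hd : dotP d k (θ + t • fun j => -(u j : ℝ)) = dotP d k θ - t * φ k := by
      simp only [dotP, φ, Pi.add_apply, Pi.smul_apply, smul_eq_mul, Int.cast_sum, Int.cast_mul,
        Finset.mul_sum, mul_add, Finset.sum_add_distrib, sub_eq_add_neg, ← Finset.sum_neg_distrib]
      congr 1
      exact Finset.sum_congr rfl fun j _ => by ring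
    have he : (((φ k + m).toNat : ℕ) : ℂ) = φ k + m := by
      have := Int.toNat_of_nonneg (hm k hk)
      exact_mod_cast this
    simp only [Polynomial.eval_monomial, circleMap, Complex.ofReal_one, one_mul, zero_add,
      ← Complex.exp_nat_mul, mul_assoc, mul_left_comm _ (p k), ← Complex.exp_add]
    rw [hd, he]
    congr 2
    push_cast
    ring

theorem setLIntegral_logLoss_trigSum_lt_top {p : (Fin d → ℤ) → ℂ} {k : Fin d → ℤ} (hk : k ∈ Λ)
    (hpk : p k ≠ 0) :
    ∫⁻ θ in Td d, logLoss (coeffNorm Λ p) ‖trigSum d Λ p θ‖ < ⊤ := by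
  obtain ⟨u, e, he, hu⟩ := exists_polynomial_norm_trigSum_eq Λ
  let D := Λ.sup e
  refine lintegral_pi_Ioc_lt_top
    ((measurable_logLoss _).comp (continuous_trigSum p).norm.measurable)
    (fun θ n => by rw [trigSum_add_two_pi]) u (ENNReal.ofReal_ne_top
      (r := 2 * Real.pi * (Real.log (coeffNorm Λ p) - Real.log (‖p k‖ / 2 ^ D)))) fun θ => ?_
  simp_rw [hu]
  refine lintegral_logLoss_polynomial_le (by positivity) ?_ fun t => ?_
  · set q := ∑ k ∈ Λ, Polynomial.monomial (e k)
      (p k * Complex.exp (-(dotP d k θ : ℂ) * Complex.I)) with hq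
    have hdeg : q.natDegree ≤ D := Polynomial.natDegree_sum_le_of_forall_le _ _ fun l hl =>
      (Polynomial.natDegree_monomial_le _).trans (Finset.le_sup hl)
    have hcoeff : ‖q.coeff (e k)‖ = ‖p k‖ := by
      rw [hq, Polynomial.finsetSum_coeff, Finset.sum_eq_single k]
      · rw [Polynomial.coeff_monomial, if_pos rfl, norm_mul, norm_exp_dotP, mul_one]
      · intro l hl hlk
        rw [Polynomial.coeff_monomial, if_neg fun h => hlk (he hl hk h)]
      · exact fun h => (h hk).elim
    have h1 := q.norm_coeff_le_choose_mul_mahlerMeasure (e k)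
    have h2 : ((q.natDegree.choose (e k) : ℕ) : ℝ) ≤ 2 ^ D := by
      exact_mod_cast (Nat.choose_le_two_pow _ _).trans (Nat.pow_le_pow_right two_pos hdeg)
    rw [div_le_iff₀' (by positivity), ← hcoeff]
    exact h1.trans (mul_le_mul_of_nonneg_right h2 q.mahlerMeasure_nonneg)
  · rw [← hu]
    exact norm_trigSum_le _ _

instance isFiniteMeasure_restrict_Td : IsFiniteMeasure (volume.restrict (Td d)) :=
  isFiniteMeasure_restrict.2 (by simp [Td, volume_pi, Measure.pi_pi])

theorem ae_ne_zero_and_integrable_log_norm_trigSum {p : (Fin d → ℤ) → ℂ} {k : Fin d → ℤ}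
    (hk : k ∈ Λ) (hpk : p k ≠ 0) :
    (∀ᵐ θ ∂(volume.restrict (Td d)), trigSum d Λ p θ ≠ 0) ∧
      IntegrableOn (fun θ => Real.log ‖trigSum d Λ p θ‖) (Td d) := by
  have hfin := setLIntegral_logLoss_trigSum_lt_top hk hpk
  have hmeas : Measurable fun θ => ‖trigSum d Λ p θ‖ := (continuous_trigSum p).norm.measurable
  have hne : ∀ᵐ θ ∂(volume.restrict (Td d)), trigSum d Λ p θ ≠ 0 := by
    filter_upwards [ae_lt_top ((measurable_logLoss _).comp hmeas) hfin.ne] with θ hθ h0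
    simp [logLoss, h0] at hθ
  refine ⟨hne, ?_⟩
  have hint : IntegrableOn (fun θ => Real.log (coeffNorm Λ p) - Real.log ‖trigSum d Λ p θ‖)
      (Td d) := by
    refine (lintegral_ofReal_ne_top_iff_integrable
      (hmeas.log.const_sub _).aestronglyMeasurable ?_).1
      (ne_of_eq_of_ne (lintegral_congr_ae ?_) hfin.ne)
    · filter_upwards [hne] with θ hθ
      simpa using Real.log_le_log (norm_pos_iff.2 hθ) (norm_trigSum_le p θ)
    · filter_upwards [hne] with θ hθ
      rw [logLoss, if_neg (norm_ne_zero_iff.2 hθ)]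
  refine ((integrable_const (Real.log (coeffNorm Λ p))).sub hint).congr (ae_of_all _ fun θ => ?_)
  simp

theorem ae_dm_of_ae_restrict {q : (Fin d → ℝ) → Prop}
    (h : ∀ᵐ θ ∂(volume.restrict (Td d)), q θ) : ∀ᵐ θ ∂(dm d), q θ :=
  Measure.ae_smul_measure h _

theorem inv_ofReal_two_pi_pow_ne_top : (ENNReal.ofReal ((2 * Real.pi) ^ d))⁻¹ ≠ ⊤ := by
  simp only [ne_eq, ENNReal.inv_eq_top, ENNReal.ofReal_eq_zero, not_le]
  positivity

instance isFiniteMeasure_dm : IsFiniteMeasure (dm d) :=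
  Measure.smul_finite _ inv_ofReal_two_pi_pow_ne_top

theorem dm_ne_zero : dm d ≠ 0 := by
  intro h
  have h1 : dm d univ = 0 := by rw [h]; rfl
  simp [dm, Td, volume_pi, Measure.pi_pi, Real.pi_pos.not_ge] at h1

theorem continuous_eval (p : (Fin d → ℤ) → ℂ) : Continuous (eval d Λ p) :=
  Complex.continuous_re.comp (continuous_trigSum p)

theorem continuous_eval_left (θ : Fin d → ℝ) : Continuous fun p => eval d Λ p θ := by
  unfold eval
  fun_prop

theorem continuous_pair (c : (Fin d → ℤ) → ℂ) : Continuous fun p => pair d Λ c p := by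
  unfold pair
  fun_prop

theorem continuous_coeffNorm : Continuous (coeffNorm Λ) := by
  unfold coeffNorm
  fun_prop

theorem abs_eval_le (p : (Fin d → ℤ) → ℂ) (θ : Fin d → ℝ) :
    |eval d Λ p θ| ≤ coeffNorm Λ p :=
  (Complex.abs_re_le_norm _).trans (norm_trigSum_le p θ)

theorem ae_eval_nonneg {p : (Fin d → ℤ) → ℂ} (hp : p ∈ Pbar d Λ) :
    ∀ᵐ θ ∂(dm d), 0 ≤ eval d Λ p θ :=
  ae_dm_of_ae_restrict (ae_restrict_of_forall_mem
    (MeasurableSet.univ_pi fun _ => measurableSet_Ioc) hp.2)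

theorem exists_mem_coeff_ne_zero {p : (Fin d → ℤ) → ℂ} (hp : p ∈ Pbar d Λ \ {0}) :
    ∃ k ∈ Λ, p k ≠ 0 := by
  by_contra! h
  refine hp.2 (funext fun k => ?_)
  by_cases hk : k ∈ Λ
  · exact h k hk
  · exact hp.1.1.1 k hk

theorem coeffNorm_pos {p : (Fin d → ℤ) → ℂ} (hp : p ∈ Pbar d Λ \ {0}) : 0 < coeffNorm Λ p := by
  obtain ⟨k, hk, hpk⟩ := exists_mem_coeff_ne_zero hp
  exact Finset.sum_pos' (fun _ _ => norm_nonneg _) ⟨k, hk, norm_pos_iff.2 hpk⟩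

theorem ae_eval_pos (hΛ : ∀ k ∈ Λ, -k ∈ Λ) {p : (Fin d → ℤ) → ℂ} (hp : p ∈ Pbar d Λ \ {0}) :
    ∀ᵐ θ ∂(dm d), 0 < eval d Λ p θ := by
  obtain ⟨k, hk, hpk⟩ := exists_mem_coeff_ne_zero hp
  filter_upwards [ae_eval_nonneg hp.1,
    ae_dm_of_ae_restrict (ae_ne_zero_and_integrable_log_norm_trigSum hk hpk).1] with θ h1 h2
  refine lt_of_le_of_ne h1 fun h => h2 ?_
  rw [← ofReal_eval_eq_trigSum hΛ hp.1.1, ← h, Complex.ofReal_zero]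

theorem integrable_log_eval (hΛ : ∀ k ∈ Λ, -k ∈ Λ) {p : (Fin d → ℤ) → ℂ}
    (hp : p ∈ Pbar d Λ \ {0}) : Integrable (fun θ => Real.log (eval d Λ p θ)) (dm d) := by
  obtain ⟨k, hk, hpk⟩ := exists_mem_coeff_ne_zero hp
  have h : IntegrableOn (fun θ => Real.log ‖trigSum d Λ p θ‖) (Td d) :=
    (ae_ne_zero_and_integrable_log_norm_trigSum hk hpk).2
  simp_rw [← ofReal_eval_eq_trigSum hΛ hp.1.1, Complex.norm_real, Real.norm_eq_abs,
    Real.log_abs] at h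
  exact Integrable.smul_measure h inv_ofReal_two_pi_pow_ne_top

theorem integrable_eval (p : (Fin d → ℤ) → ℂ) : Integrable (eval d Λ p) (dm d) :=
  (integrable_const (coeffNorm Λ p)).mono' (continuous_eval p).aestronglyMeasurable
    (ae_of_all _ (abs_eval_le p))

theorem integrable_eval_mul_log_eval (hΛ : ∀ k ∈ Λ, -k ∈ Λ) (p : (Fin d → ℤ) → ℂ)
    {q : (Fin d → ℤ) → ℂ} (hq : q ∈ Pbar d Λ \ {0}) :
    Integrable (fun θ => eval d Λ p θ * Real.log (eval d Λ q θ)) (dm d) :=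
  (integrable_log_eval hΛ hq).bdd_mul (continuous_eval p).aestronglyMeasurable
    (ae_of_all _ (abs_eval_le p))

theorem integral_eval_pos (hΛ : ∀ k ∈ Λ, -k ∈ Λ) {p : (Fin d → ℤ) → ℂ}
    (hp : p ∈ Pbar d Λ \ {0}) : 0 < ∫ θ, eval d Λ p θ ∂(dm d) := by
  have hnn := ae_eval_nonneg hp.1
  refine lt_of_le_of_ne (integral_nonneg_of_ae hnn) fun h => ?_
  have h0 := (integral_eq_zero_iff_of_nonneg_ae hnn (integrable_eval p)).1 h.symm
  have : ∀ᵐ θ ∂(dm d), False := by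
    filter_upwards [h0, ae_eval_pos hΛ hp] with θ h1 h2
    exact h2.ne' h1
  exact dm_ne_zero (ae_eq_bot.1 (Filter.eventually_false_iff_eq_bot.1 this))

theorem isClosed_Pbar : IsClosed (Pbar d Λ) := by
  simp only [Pbar, IsCoeff, ofPred_and, ofPred_forall]
  refine IsClosed.inter (IsClosed.inter ?_ ?_) ?_
  · exact isClosed_iInter fun k => isClosed_iInter fun _ =>
      isClosed_eq (continuous_apply k) continuous_const
  · exact isClosed_iInter fun k => isClosed_eq (continuous_apply _)
      (Complex.continuous_conj.comp (continuous_apply k))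
  · exact isClosed_iInter fun θ => isClosed_iInter fun _ =>
      isClosed_le continuous_const (continuous_eval_left θ)

theorem isCompact_Pbar_inter_coeffNorm_mem_Icc (a b : ℝ) :
    IsCompact {q | q ∈ Pbar d Λ ∧ coeffNorm Λ q ∈ Icc a b} := by
  classical
  refine (isCompact_univ_pi fun k : Fin d → ℤ =>
    isCompact_closedBall (0 : ℂ) (if k ∈ Λ then b else 0)).of_isClosed_subset
    (isClosed_Pbar.inter (isClosed_Icc.preimage continuous_coeffNorm)) ?_
  rintro q ⟨hq, -, hb⟩ k -
  rw [mem_closedBall_zero_iff]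
  split_ifs with hk
  · exact (Finset.single_le_sum (f := fun k => ‖q k‖) (fun _ _ => norm_nonneg _) hk).trans hb
  · simp [hq.1.1 k hk]

theorem coeffNorm_smul (a : ℝ) (p : (Fin d → ℤ) → ℂ) :
    coeffNorm Λ (fun k => (a : ℂ) * p k) = |a| * coeffNorm Λ p := by
  simp only [coeffNorm, norm_mul, ← Finset.mul_sum, Complex.norm_real, Real.norm_eq_abs]

theorem smul_mem_Pbar {p : (Fin d → ℤ) → ℂ} (hp : p ∈ Pbar d Λ) {a : ℝ} (ha : 0 ≤ a) :
    (fun k => (a : ℂ) * p k) ∈ Pbar d Λ := by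
  refine ⟨⟨fun k hk => by simp [hp.1.1 k hk], fun k => by simp [hp.1.2 k]⟩, fun θ hθ => ?_⟩
  have : eval d Λ (fun k => (a : ℂ) * p k) θ = a * eval d Λ p θ := by
    simp only [eval, mul_assoc, ← Finset.mul_sum, Complex.re_ofReal_mul]
  rw [this]
  exact mul_nonneg ha (hp.2 θ hθ)

theorem exists_pos_mul_coeffNorm_le_pair {c : (Fin d → ℤ) → ℂ} (hc : c ∈ Cplus d Λ) :
    ∃ ε > 0, ∀ q ∈ Pbar d Λ \ {0}, ε * coeffNorm Λ q ≤ pair d Λ c q := by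
  have hK := isCompact_Pbar_inter_coeffNorm_mem_Icc (d := d) (Λ := Λ) 1 1
  have hpos : ∀ q ∈ {q | q ∈ Pbar d Λ ∧ coeffNorm Λ q ∈ Icc 1 1}, 0 < pair d Λ c q := by
    rintro q ⟨hq, h1, -⟩
    refine hc.2 q hq ?_
    rintro rfl
    simp [coeffNorm] at h1
    linarith
  obtain ⟨ε, hε, hmin⟩ := hK.exists_forall_le' (continuous_pair c).continuousOn hpos
  refine ⟨ε, hε, fun q hq => ?_⟩
  have hN := coeffNorm_pos hq
  have hmem := hmin _ (show (fun k => (((coeffNorm Λ q)⁻¹ : ℝ) : ℂ) * q k) ∈ _ from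
    ⟨smul_mem_Pbar hq.1 (inv_nonneg.2 hN.le), by
      rw [coeffNorm_smul, abs_of_pos (inv_pos.2 hN), inv_mul_cancel₀ hN.ne']
      exact ⟨le_rfl, le_rfl⟩⟩)
  have hp : pair d Λ c (fun k => (((coeffNorm Λ q)⁻¹ : ℝ) : ℂ) * q k) =
      (coeffNorm Λ q)⁻¹ * pair d Λ c q := by
    simp only [pair, map_mul, Complex.conj_ofReal, mul_left_comm (c _), ← Finset.mul_sum,
      Complex.re_ofReal_mul]
  rwa [hp, inv_mul_eq_div, le_div_iff₀ hN] at hmem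

/-- The dual functional dominates a linear minus a logarithmic function of the coefficient norm. -/
theorem mul_coeffNorm_sub_le_J (hΛ : ∀ k ∈ Λ, -k ∈ Λ) {c P Q : (Fin d → ℤ) → ℂ} {ε : ℝ}
    (hP : P ∈ Pbar d Λ) (hQ : Q ∈ Pbar d Λ \ {0})
    (hε : ε * coeffNorm Λ Q ≤ pair d Λ c Q) :
    ε * coeffNorm Λ Q - (∫ θ, eval d Λ P θ ∂(dm d)) * Real.log (coeffNorm Λ Q) ≤
      J d Λ c P Q := by
  refine sub_le_sub hε ?_
  rw [← integral_mul_const]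
  refine integral_mono_ae (integrable_eval_mul_log_eval hΛ P hQ)
    ((integrable_eval P).mul_const _) ?_
  filter_upwards [ae_eval_nonneg hP, ae_eval_pos hΛ hQ] with θ h1 h2
  exact mul_le_mul_of_nonneg_left
    (Real.log_le_log h2 ((le_abs_self _).trans (abs_eval_le Q θ))) h1

theorem exists_bounds_of_mul_sub_mul_log_le {ε I : ℝ} (hε : 0 < ε) (hI : 0 < I) (r : ℝ) :
    ∃ a b : ℝ, 0 < a ∧ ∀ x, 0 < x → ε * x - I * Real.log x ≤ r → x ∈ Icc a b := by
  let s := ε / (2 * I)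
  have hs : 0 < s := by positivity
  refine ⟨Real.exp (-r / I), (r - I - I * Real.log s) / (ε / 2), Real.exp_pos _,
    fun x hx h => ⟨?_, ?_⟩⟩
  · rw [← Real.le_log_iff_exp_le hx, div_le_iff₀ hI]
    nlinarith [mul_pos hε hx]
  · rw [le_div_iff₀ (by positivity)]
    have h1 := Real.log_le_sub_one_of_pos (mul_pos hs hx)
    rw [Real.log_mul hs.ne' hx.ne'] at h1
    have h2 : I * (s * x) = ε / 2 * x := by
      simp only [s]
      field_simp
    nlinarith [mul_le_mul_of_nonneg_left h1 hI.le]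

/-- Sequential lower semicontinuity of the dual functional, from Fatou's lemma. -/
theorem J_le_of_tendsto (hΛ : ∀ k ∈ Λ, -k ∈ Λ) {c P Q : (Fin d → ℤ) → ℂ} {r b : ℝ}
    {q : ℕ → (Fin d → ℤ) → ℂ} (hP : P ∈ Pbar d Λ) (hQ : Q ∈ Pbar d Λ \ {0})
    (hq : ∀ n, q n ∈ Pbar d Λ \ {0}) (hb : ∀ n, coeffNorm Λ (q n) ≤ b)
    (hJ : ∀ n, J d Λ c P (q n) ≤ r) (hlim : Filter.Tendsto q Filter.atTop (nhds Q)) :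
    J d Λ c P Q ≤ r := by
  let g : ((Fin d → ℤ) → ℂ) → (Fin d → ℝ) → ℝ := fun p θ =>
    eval d Λ P θ * Real.log b - eval d Λ P θ * Real.log (eval d Λ p θ)
  let A := (∫ θ, eval d Λ P θ ∂(dm d)) * Real.log b
  have hint : ∀ p ∈ Pbar d Λ \ {0}, Integrable (g p) (dm d) := fun p hp =>
    ((integrable_eval P).mul_const _).sub (integrable_eval_mul_log_eval hΛ P hp)
  have hA : ∀ p ∈ Pbar d Λ \ {0}, ∫ θ, g p θ ∂(dm d) = A + J d Λ c P p - pair d Λ c p := by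
    intro p hp
    simp only [g, A, J]
    rw [integral_sub ((integrable_eval P).mul_const _) (integrable_eval_mul_log_eval hΛ P hp),
      integral_mul_const]
    ring
  have hnn : ∀ p ∈ Pbar d Λ \ {0}, coeffNorm Λ p ≤ b → 0 ≤ᵐ[dm d] g p := by
    intro p hp hpb
    filter_upwards [ae_eval_nonneg hP, ae_eval_pos hΛ hp] with θ h1 h2
    exact sub_nonneg.2 (mul_le_mul_of_nonneg_left
      (Real.log_le_log h2 (((le_abs_self _).trans (abs_eval_le p θ)).trans hpb)) h1)
  have hQb : coeffNorm Λ Q ≤ b :=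
    le_of_tendsto' ((continuous_coeffNorm.tendsto Q).comp hlim) hb
  have hlint : ∀ p ∈ Pbar d Λ \ {0}, coeffNorm Λ p ≤ b →
      ∫⁻ θ, ENNReal.ofReal (g p θ) ∂(dm d) = ENNReal.ofReal (∫ θ, g p θ ∂(dm d)) :=
    fun p hp hpb => (ofReal_integral_eq_lintegral_ofReal (hint p hp) (hnn p hp hpb)).symm
  have hbound : Filter.Tendsto (fun n => A + r - pair d Λ c (q n)) Filter.atTop
      (nhds (A + r - pair d Λ c Q)) :=
    tendsto_const_nhds.sub (((continuous_pair c).tendsto Q).comp hlim)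
  have hgq : ∀ n, ∫ θ, g (q n) θ ∂(dm d) ≤ A + r - pair d Λ c (q n) := fun n => by
    rw [hA _ (hq n)]
    linarith [hJ n]
  have hlimnn : 0 ≤ A + r - pair d Λ c Q :=
    ge_of_tendsto' hbound fun n =>
      (integral_nonneg_of_ae (hnn _ (hq n) (hb n))).trans (hgq n)
  have hmeas : ∀ p, Measurable fun θ => ENNReal.ofReal (g p θ) := fun p => by
    have h1 := (continuous_eval (d := d) (Λ := Λ) P).measurable
    have h2 := (continuous_eval (d := d) (Λ := Λ) p).measurable
    exact ((h1.mul_const _).sub (h1.mul h2.log)).ennreal_ofReal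
  have key : ENNReal.ofReal (∫ θ, g Q θ ∂(dm d)) ≤ ENNReal.ofReal (A + r - pair d Λ c Q) := by
    rw [← hlint Q hQ hQb]
    calc ∫⁻ θ, ENNReal.ofReal (g Q θ) ∂(dm d)
        = ∫⁻ θ, Filter.liminf (fun n => ENNReal.ofReal (g (q n) θ)) Filter.atTop ∂(dm d) := by
          refine lintegral_congr_ae ?_
          filter_upwards [ae_eval_pos hΛ hQ] with θ hθ
          refine (Filter.Tendsto.liminf_eq (ENNReal.tendsto_ofReal ?_)).symm
          exact tendsto_const_nhds.sub (tendsto_const_nhds.mul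
            ((((continuous_eval_left θ).tendsto Q).comp hlim).log hθ.ne'))
      _ ≤ Filter.liminf (fun n => ∫⁻ θ, ENNReal.ofReal (g (q n) θ) ∂(dm d)) Filter.atTop :=
          lintegral_liminf_le fun n => hmeas (q n)
      _ ≤ Filter.liminf (fun n => ENNReal.ofReal (A + r - pair d Λ c (q n))) Filter.atTop :=
          Filter.liminf_le_liminf (Filter.Eventually.of_forall fun n => by
            rw [hlint _ (hq n) (hb n)]
            exact ENNReal.ofReal_le_ofReal (hgq n))
      _ = ENNReal.ofReal (A + r - pair d Λ c Q) :=
          (ENNReal.tendsto_ofReal hbound).liminf_eq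
  rw [ENNReal.ofReal_le_ofReal_iff hlimnn, hA Q hQ] at key
  linarith

/-- for any P ∈ 𝔓̄₊ \ {0} and c ∈ ℭ₊, the sublevel sets of the dual
functional J_P in 𝔓̄₊ \ {0} are compact. -/
theorem statement7 (d : ℕ) (hd : 1 ≤ d) (Λ : Finset (Fin d → ℤ))
    (h0 : (0 : Fin d → ℤ) ∈ Λ) (hΛ : ∀ k ∈ Λ, -k ∈ Λ)
    (c P : (Fin d → ℤ) → ℂ) (hc : c ∈ Cplus d Λ) (hP : P ∈ Pbar d Λ \ {0}) (r : ℝ) :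
    IsCompact {Q | Q ∈ Pbar d Λ \ {0} ∧ J d Λ c P Q ≤ r} := by
  obtain ⟨ε, hε, hpair⟩ := exists_pos_mul_coeffNorm_le_pair hc
  obtain ⟨a, b, ha, hab⟩ := exists_bounds_of_mul_sub_mul_log_le hε (integral_eval_pos hΛ hP) r
  have hK := isCompact_Pbar_inter_coeffNorm_mem_Icc (d := d) (Λ := Λ) a b
  have hsub : {Q | Q ∈ Pbar d Λ \ {0} ∧ J d Λ c P Q ≤ r} ⊆
      {q | q ∈ Pbar d Λ ∧ coeffNorm Λ q ∈ Icc a b} := fun Q hQ =>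
    ⟨hQ.1.1, hab _ (coeffNorm_pos hQ.1)
      ((mul_coeffNorm_sub_le_J hΛ hP.1 hQ.1 (hpair Q hQ.1)).trans hQ.2)⟩
  refine hK.of_isClosed_subset (IsSeqClosed.isClosed fun q Q hq hlim => ?_) hsub
  have hQK := hK.isClosed.isSeqClosed (fun n => hsub (hq n)) hlim
  have hQ : Q ∈ Pbar d Λ \ {0} := by
    refine ⟨hQK.1, ?_⟩
    rintro rfl
    have := hQK.2.1
    simp [coeffNorm] at this
    linarith
  exact ⟨hQ, J_le_of_tendsto hΛ hP.1 hQ (fun n => (hq n).1) (fun n => (hsub (hq n)).2.2)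
    (fun n => (hq n).2) hlim⟩

end RCE
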